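/- (Transformation of the mean curvature under Möbius transformations.) Let U ⊆ ℝ² be open, Φ : U → S³ ⊂ ℝ⁴ a smooth conformal immersion into S³ with conformal factor e^λ, Gauss map n and mean curvature H. Let a ∈ ℝ⁴ with |a| < 1 and set Φ̃ := Ψ_a ∘ Φ and μ := μ_a ∘ Φ. Then Φ̃ is a smooth conformal immersion into S³ with conformal factor e^{λ+μ}, and its mean curvature H̃ (computed from Φ̃, its Gauss map ñ and its conformal factor) satisfies at every point of U: H̃ = e^{−μ} ( H − 2 (a·n)/(1 + |a|² − 2 a·Φ) ). -/

import Mathlib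

noncomputable section

open Real MeasureTheory
open scoped ENNReal RealInnerProductSpace

/-- The plane `ℝ²`. -/
abbrev RR2 := ℝ × ℝ
/-- Euclidean `ℝ⁴`. -/
abbrev RR4 := EuclideanSpace ℝ (Fin 4)

/-- Partial derivative in the `x₁` direction of an `ℝ⁴`-valued map on `ℝ²`. -/
def d1 (f : RR2 → RR4) (x : RR2) : RR4 := fderiv ℝ f x (1, 0)
/-- Partial derivative in the `x₂` direction of an `ℝ⁴`-valued map on `ℝ²`. -/
def d2 (f : RR2 → RR4) (x : RR2) : RR4 := fderiv ℝ f x (0, 1)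
/-- Partial derivative in the `x₁` direction of a scalar map on `ℝ²`. -/
def d1s (f : RR2 → ℝ) (x : RR2) : ℝ := fderiv ℝ f x (1, 0)
/-- Partial derivative in the `x₂` direction of a scalar map on `ℝ²`. -/
def d2s (f : RR2 → ℝ) (x : RR2) : ℝ := fderiv ℝ f x (0, 1)

/-- Determinant of four vectors of `ℝ⁴`. -/
def det4 (a b c d : RR4) : ℝ :=
  Matrix.det (Matrix.of ![(fun i => a i), (fun i => b i), (fun i => c i), (fun i => d i)])

/-- `Φ : U → S³ ⊂ ℝ⁴` is a smooth conformal immersion into `S³` with conformal factor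
`e^lam` and (positively oriented) Gauss map `n`. -/
structure IsConformalImmersionS3 (U : Set RR2) (Φ : RR2 → RR4) (lam : RR2 → ℝ)
    (n : RR2 → RR4) : Prop where
  smooth_Phi : ContDiffOn ℝ (⊤ : ℕ∞) Φ U
  smooth_lam : ContDiffOn ℝ (⊤ : ℕ∞) lam U
  smooth_n : ContDiffOn ℝ (⊤ : ℕ∞) n U
  mem_sphere : ∀ x ∈ U, ‖Φ x‖ = 1
  conf_orth : ∀ x ∈ U, ⟪d1 Φ x, d2 Φ x⟫ = 0
  conf_norm1 : ∀ x ∈ U, ‖d1 Φ x‖ = exp (lam x)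
  conf_norm2 : ∀ x ∈ U, ‖d2 Φ x‖ = exp (lam x)
  n_norm : ∀ x ∈ U, ‖n x‖ = 1
  n_orth_Phi : ∀ x ∈ U, ⟪n x, Φ x⟫ = 0
  n_orth_d1 : ∀ x ∈ U, ⟪n x, d1 Φ x⟫ = 0
  n_orth_d2 : ∀ x ∈ U, ⟪n x, d2 Φ x⟫ = 0
  oriented : ∀ x ∈ U, 0 < det4 (Φ x) (d1 Φ x) (d2 Φ x) (n x)

/-- Second fundamental form coefficient `I₁₁ = n·∂²_{x₁x₁}Φ`. -/
def I11 (Φ n : RR2 → RR4) (x : RR2) : ℝ := ⟪n x, d1 (d1 Φ) x⟫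
/-- Second fundamental form coefficient `I₁₂ = n·∂²_{x₁x₂}Φ`. -/
def I12 (Φ n : RR2 → RR4) (x : RR2) : ℝ := ⟪n x, d2 (d1 Φ) x⟫
/-- Second fundamental form coefficient `I₂₂ = n·∂²_{x₂x₂}Φ`. -/
def I22 (Φ n : RR2 → RR4) (x : RR2) : ℝ := ⟪n x, d2 (d2 Φ) x⟫

/-- Mean curvature `H = (1/2) e^{-2λ} (I₁₁ + I₂₂)`. -/
def meanCurv (Φ : RR2 → RR4) (lam : RR2 → ℝ) (n : RR2 → RR4) (x : RR2) : ℝ :=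
  (1 / 2) * exp (-(2 * lam x)) * (I11 Φ n x + I22 Φ n x)

/-- Trace-free Weingarten coefficient `I⁰₁₁ = (I₁₁ - I₂₂)/2`. -/
def I011 (Φ n : RR2 → RR4) (x : RR2) : ℝ := (I11 Φ n x - I22 Φ n x) / 2
/-- Trace-free Weingarten coefficient `I⁰₁₂ = I₁₂`. -/
def I012 (Φ n : RR2 → RR4) (x : RR2) : ℝ := I12 Φ n x

/-- The Möbius transformation `Ψ_a(y) = (1-|a|²)(y-a)/|y-a|² - a` of the sphere `S³`. -/
def moebius (a y : RR4) : RR4 := (1 - ‖a‖ ^ 2) • (‖y - a‖ ^ 2)⁻¹ • (y - a) - a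

/-- The conformal factor `e^{μ_a(y)} = (1-|a|²)/(1+|a|²-2a·y)` of `Ψ_a` on `S³`. -/
def confFactor (a y : RR4) : ℝ := (1 - ‖a‖ ^ 2) / (1 + ‖a‖ ^ 2 - 2 * ⟪a, y⟫)


/-- Reflection in the hyperplane orthogonal to `q`. -/
def reflq (q v : RR4) : RR4 := v - (2 * ⟪q, v⟫ * (‖q‖ ^ 2)⁻¹) • q

lemma reflq_inner (q u v : RR4) (hq : q ≠ 0) : ⟪reflq q u, reflq q v⟫ = ⟪u, v⟫ := by
  have h0 : ‖q‖ ≠ 0 := norm_ne_zero_iff.2 hq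
  simp only [reflq, inner_sub_left, inner_sub_right, inner_smul_left, inner_smul_right,
    real_inner_self_eq_norm_sq, real_inner_comm q u, real_inner_comm q v, conj_trivial]
  field_simp
  ring

lemma reflq_norm (q u : RR4) (hq : q ≠ 0) : ‖reflq q u‖ = ‖u‖ := by
  have := reflq_inner q u u hq
  rw [real_inner_self_eq_norm_sq, real_inner_self_eq_norm_sq] at this
  exact (sq_eq_sq₀ (norm_nonneg _) (norm_nonneg _)).1 this

lemma rho_eq (a y : RR4) (hy : ‖y‖ = 1) : ‖y - a‖ ^ 2 = 1 + ‖a‖ ^ 2 - 2 * ⟪a, y⟫ := by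
  rw [norm_sub_sq_real, hy, real_inner_comm]; ring

lemma moebius_eq (a y : RR4) (hy : ‖y‖ = 1) (hq : y - a ≠ 0) :
    moebius a y = - reflq (y - a) y := by
  have h0 : ‖y - a‖ ^ 2 ≠ 0 := pow_ne_zero _ (norm_ne_zero_iff.2 hq)
  have h1 := rho_eq a y hy
  have h2 : 2 * ⟪y - a, y⟫ = ‖y - a‖ ^ 2 + (1 - ‖a‖ ^ 2) := by
    rw [inner_sub_left, real_inner_self_eq_norm_sq, hy, h1]; ring
  rw [moebius, reflq, h2, add_mul, mul_inv_cancel₀ h0, smul_smul]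
  module

lemma det4_reflq (q a b c d : RR4) (hq : q ≠ 0) :
    det4 (reflq q a) (reflq q b) (reflq q c) (reflq q d) = - det4 a b c d := by
  have h0 : ‖q‖ ^ 2 ≠ 0 := pow_ne_zero _ (norm_ne_zero_iff.2 hq)
  have hin : ∀ v : RR4, ⟪q, v⟫ = q 0 * v 0 + q 1 * v 1 + q 2 * v 2 + q 3 * v 3 := by
    intro v
    simp [PiLp.inner_apply, Fin.sum_univ_four, mul_comm]
  have hM : (Matrix.of ![(fun i => reflq q a i), (fun i => reflq q b i), (fun i => reflq q c i),
      (fun i => reflq q d i)]) = Matrix.of ![(fun i => a i), (fun i => b i), (fun i => c i),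
      (fun i => d i)] * (1 + Matrix.replicateCol Unit (fun i => q i) *
        Matrix.replicateRow Unit (fun i => -(2 * (‖q‖ ^ 2)⁻¹) * q i)) := by
    rw [Matrix.mul_add, Matrix.mul_one, ← Matrix.mul_assoc]
    ext i j
    rw [Matrix.add_apply, Matrix.mul_apply]
    simp only [Matrix.mul_apply, Fin.sum_univ_four, Finset.univ_unique, Finset.sum_singleton,
      Matrix.replicateCol_apply, Matrix.replicateRow_apply]
    fin_cases i <;>
    simp [reflq, hin] <;> ring
  rw [det4, hM, Matrix.det_mul, Matrix.det_one_add_replicateCol_mul_replicateRow, det4]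
  have : (fun i => -(2 * (‖q‖ ^ 2)⁻¹) * q i) ⬝ᵥ (fun i => q i) = -2 := by
    have h1 := hin q
    rw [real_inner_self_eq_norm_sq] at h1
    simp only [dotProduct, Fin.sum_univ_four]
    rw [show -(2 * (‖q‖ ^ 2)⁻¹) * q 0 * q 0 + -(2 * (‖q‖ ^ 2)⁻¹) * q 1 * q 1 +
      -(2 * (‖q‖ ^ 2)⁻¹) * q 2 * q 2 + -(2 * (‖q‖ ^ 2)⁻¹) * q 3 * q 3 =
      -(2 * (‖q‖ ^ 2)⁻¹) * (q 0 * q 0 + q 1 * q 1 + q 2 * q 2 + q 3 * q 3) by ring, ← h1]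
    field_simp
  rw [this]; ring

lemma det4_smul (r s t u : ℝ) (a b c d : RR4) :
    det4 (r • a) (s • b) (t • c) (u • d) = r * s * t * u * det4 a b c d := by
  simp [det4, Matrix.det_succ_row_zero, Fin.sum_univ_succ, Fin.succAbove]
  ring

lemma normal_unique (p q r u v : RR4) (hu : ‖u‖ = 1) (hv : ‖v‖ = 1)
    (up : ⟪u, p⟫ = 0) (uq : ⟪u, q⟫ = 0) (ur : ⟪u, r⟫ = 0)
    (vp : ⟪v, p⟫ = 0) (vq : ⟪v, q⟫ = 0) (vr : ⟪v, r⟫ = 0)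
    (hdu : 0 < det4 p q r u) (hdv : 0 < det4 p q r v) : u = v := by
  have hw : v - ⟪u, v⟫ • u = 0 := by
    set w := v - ⟪u, v⟫ • u with hwd
    have hin : ∀ z : RR4, ⟪w, z⟫ = z 0 * w 0 + z 1 * w 1 + z 2 * w 2 + z 3 * w 3 := by
      intro v
      simp [PiLp.inner_apply, Fin.sum_univ_four]
    have h1 : ⟪w, p⟫ = 0 := by simp [hwd, inner_sub_left, inner_smul_left, up, vp]
    have h2 : ⟪w, q⟫ = 0 := by simp [hwd, inner_sub_left, inner_smul_left, uq, vq]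
    have h3 : ⟪w, r⟫ = 0 := by simp [hwd, inner_sub_left, inner_smul_left, ur, vr]
    have h4 : ⟪w, u⟫ = 0 := by
      simp [hwd, inner_sub_left, inner_smul_left, hu, real_inner_comm]
    rw [hin] at h1 h2 h3 h4
    have := Matrix.eq_zero_of_mulVec_eq_zero (M := Matrix.of ![(fun i => p i), (fun i => q i),
      (fun i => r i), (fun i => u i)]) (v := fun i => w i) hdu.ne' (by
        ext i
        fin_cases i <;> simp [Matrix.mulVec, dotProduct, Fin.sum_univ_four, h1, h2, h3, h4])
    ext i
    exact congrFun this i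
  have hvu : v = ⟪u, v⟫ • u := sub_eq_zero.1 hw
  set t := ⟪u, v⟫
  have ht : 0 < t := by
    have := det4_smul 1 1 1 t p q r u
    rw [one_smul, one_smul, one_smul, ← hvu] at this
    rw [this] at hdv
    have := pos_of_mul_pos_left hdv hdu.le
    simpa using this
  have : t = 1 := by
    rw [hvu, norm_smul, hu, Real.norm_of_nonneg ht.le, mul_one] at hv
    exact hv
  rw [hvu, this, one_smul]

/-- First derivative of `moebius a` along a curve. -/
lemma hasDerivAt_moebius (a : RR4) (f : ℝ → RR4) (f' : RR4) (t : ℝ) (hf : HasDerivAt f f' t)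
    (hq : f t - a ≠ 0) :
    HasDerivAt (fun s => moebius a (f s))
      (((1 - ‖a‖ ^ 2) * (‖f t - a‖ ^ 2)⁻¹) • reflq (f t - a) f') t := by
  have h0 : ‖f t - a‖ ^ 2 ≠ 0 := pow_ne_zero _ (norm_ne_zero_iff.2 hq)
  have hq' : HasDerivAt (fun s => f s - a) f' t := hf.sub_const a
  have h1 := hq'.norm_sq.inv h0
  have h2 := ((h1.smul hq').const_smul (1 - ‖a‖ ^ 2)).sub_const a
  refine (h2.congr_deriv ?_)
  simp only [reflq, Pi.inv_apply]
  match_scalars <;> field_simp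

/-- Second derivative. -/
lemma hasDerivAt_moebius2 (a m : RR4) (f g : ℝ → RR4) (g' : RR4) (t : ℝ)
    (hf : HasDerivAt f (g t) t) (hg : HasDerivAt g g' t)
    (hq : f t - a ≠ 0) (hm : ⟪m, g t⟫ = 0) :
    ∃ D, HasDerivAt (fun s => ((1 - ‖a‖ ^ 2) * (‖f s - a‖ ^ 2)⁻¹) • reflq (f s - a) (g s)) D t ∧
      ⟪reflq (f t - a) m, D⟫ = (1 - ‖a‖ ^ 2) * (‖f t - a‖ ^ 2)⁻¹ *
        (⟪m, g'⟫ + 2 * ⟪f t - a, m⟫ * ‖g t‖ ^ 2 * (‖f t - a‖ ^ 2)⁻¹) := by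
  have h0 : ‖f t - a‖ ^ 2 ≠ 0 := pow_ne_zero _ (norm_ne_zero_iff.2 hq)
  have h0' : ‖f t - a‖ ≠ 0 := norm_ne_zero_iff.2 hq
  have hq' : HasDerivAt (fun s => f s - a) (g t) t := hf.sub_const a
  have h1 := hq'.norm_sq.inv h0
  have h3 := (((hq'.inner ℝ hg).const_mul 2).mul h1).smul hq'
  have h4 := (h1.const_mul (1 - ‖a‖ ^ 2)).smul (hg.sub h3)
  refine ⟨_, h4, ?_⟩
  simp only [reflq, Pi.inv_apply, Pi.mul_apply, Pi.sub_apply, Pi.smul_apply', Pi.smul_apply]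
  generalize f t - a = q at *
  generalize g t = p at *
  simp only [inner_sub_left, inner_sub_right, inner_add_right, inner_smul_left, inner_smul_right,
    real_inner_self_eq_norm_sq, real_inner_comm q m, real_inner_comm q p, real_inner_comm q g',
    conj_trivial, hm]
  field_simp
  ring

lemma curve_deriv (F : RR2 → RR4) (x v : RR2) (hF : DifferentiableAt ℝ F x) :
    HasDerivAt (fun t : ℝ => F (x + t • v)) (fderiv ℝ F x v) 0 := by
  have hl : HasDerivAt (fun t : ℝ => x + t • v) v 0 := by
    simpa using ((hasDerivAt_id (0 : ℝ)).smul_const v).const_add x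
  have : HasFDerivAt F (fderiv ℝ F x) (x + (0 : ℝ) • v) := by simpa using hF.hasFDerivAt
  exact this.comp_hasDerivAt 0 hl

lemma moebius_smooth (U : Set RR2) (Φ : RR2 → RR4) (a : RR4) (hΦ : ContDiffOn ℝ (⊤ : ℕ∞) Φ U)
    (hq : ∀ x ∈ U, Φ x - a ≠ 0) : ContDiffOn ℝ (⊤ : ℕ∞) (fun x => moebius a (Φ x)) U := by
  have h1 : ContDiffOn ℝ (⊤ : ℕ∞) (fun x => Φ x - a) U := hΦ.sub contDiffOn_const
  have h2 : ContDiffOn ℝ (⊤ : ℕ∞) (fun x => (‖Φ x - a‖ ^ 2)⁻¹) U :=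
    (h1.norm_sq ℝ).inv (fun x hx => pow_ne_zero _ (norm_ne_zero_iff.2 (hq x hx)))
  exact ((h2.smul h1).const_smul (1 - ‖a‖ ^ 2)).sub contDiffOn_const

lemma reflq_smooth (U : Set RR2) (Φ n : RR2 → RR4) (a : RR4) (hΦ : ContDiffOn ℝ (⊤ : ℕ∞) Φ U)
    (hn : ContDiffOn ℝ (⊤ : ℕ∞) n U)
    (hq : ∀ x ∈ U, Φ x - a ≠ 0) :
    ContDiffOn ℝ (⊤ : ℕ∞) (fun x => reflq (Φ x - a) (n x)) U := by
  have h1 : ContDiffOn ℝ (⊤ : ℕ∞) (fun x => Φ x - a) U := hΦ.sub contDiffOn_const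
  have h2 : ContDiffOn ℝ (⊤ : ℕ∞) (fun x => (‖Φ x - a‖ ^ 2)⁻¹) U :=
    (h1.norm_sq ℝ).inv (fun x hx => pow_ne_zero _ (norm_ne_zero_iff.2 (hq x hx)))
  exact hn.sub (((contDiffOn_const.mul (h1.inner ℝ hn)).mul h2).smul h1)

lemma fderiv_moebius (U : Set RR2) (hU : IsOpen U) (Φ : RR2 → RR4) (a : RR4)
    (hΦ : ContDiffOn ℝ (⊤ : ℕ∞) Φ U)
    (hq : ∀ x ∈ U, Φ x - a ≠ 0) (v : RR2) (x : RR2) (hx : x ∈ U) :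
    fderiv ℝ (fun x => moebius a (Φ x)) x v =
      ((1 - ‖a‖ ^ 2) * (‖Φ x - a‖ ^ 2)⁻¹) • reflq (Φ x - a) (fderiv ℝ Φ x v) := by
  have hd : DifferentiableAt ℝ Φ x :=
    (hΦ.contDiffAt (hU.mem_nhds hx)).differentiableAt (by simp)
  have hd' : DifferentiableAt ℝ (fun x => moebius a (Φ x)) x :=
    ((moebius_smooth U Φ a hΦ hq).contDiffAt (hU.mem_nhds hx)).differentiableAt (by simp)
  have h1 := hasDerivAt_moebius a _ _ _ (curve_deriv Φ x v hd) (by simpa using hq x hx)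
  have h2 := (curve_deriv _ x v hd').unique h1
  simpa using h2

lemma fderiv2_moebius (U : Set RR2) (hU : IsOpen U) (Φ : RR2 → RR4) (a m : RR4)
    (hΦ : ContDiffOn ℝ (⊤ : ℕ∞) Φ U)
    (hq : ∀ x ∈ U, Φ x - a ≠ 0) (v : RR2) (x : RR2) (hx : x ∈ U)
    (hm : ⟪m, fderiv ℝ Φ x v⟫ = 0) :
    ⟪reflq (Φ x - a) m,
      fderiv ℝ (fun y => fderiv ℝ (fun x => moebius a (Φ x)) y v) x v⟫ =
      (1 - ‖a‖ ^ 2) * (‖Φ x - a‖ ^ 2)⁻¹ *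
        (⟪m, fderiv ℝ (fun y => fderiv ℝ Φ y v) x v⟫
          + 2 * ⟪Φ x - a, m⟫ * ‖fderiv ℝ Φ x v‖ ^ 2 * (‖Φ x - a‖ ^ 2)⁻¹) := by
  have hn := hU.mem_nhds hx
  have hE : (fun y => fderiv ℝ (fun x => moebius a (Φ x)) y v) =ᶠ[nhds x]
      (fun y => ((1 - ‖a‖ ^ 2) * (‖Φ y - a‖ ^ 2)⁻¹) • reflq (Φ y - a) (fderiv ℝ Φ y v)) := by
    filter_upwards [hn] with y hy
    exact fderiv_moebius U hU Φ a hΦ hq v y hy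
  have hS : ∀ F : RR2 → RR4, ContDiffOn ℝ (⊤ : ℕ∞) F U →
      DifferentiableAt ℝ (fun y => fderiv ℝ F y v) x := by
    intro F hF
    have h1 : ContDiffOn ℝ (⊤ : ℕ∞) (fderiv ℝ F) U := hF.fderiv_of_isOpen hU (by simp)
    exact ((h1.contDiffAt hn).differentiableAt (by simp)).clm_apply (differentiableAt_const v)
  have hd : DifferentiableAt ℝ Φ x := (hΦ.contDiffAt hn).differentiableAt (by simp)
  have hdE := hE.differentiableAt_iff.1 (hS _ (moebius_smooth U Φ a hΦ hq))
  obtain ⟨D, hD, hD2⟩ := hasDerivAt_moebius2 a m (fun t => Φ (x + t • v))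
    (fun t => fderiv ℝ Φ (x + t • v) v) _ 0 (by simpa using curve_deriv Φ x v hd)
    (curve_deriv _ x v (hS Φ hΦ)) (by simpa using hq x hx) (by simpa using hm)
  have h2 := (curve_deriv _ x v hdE).unique hD
  rw [hE.fderiv_eq, h2]
  simpa using hD2

lemma moebius_immersion (U : Set RR2) (hU : IsOpen U)
    (Φ : RR2 → RR4) (lam : RR2 → ℝ) (n : RR2 → RR4)
    (h : IsConformalImmersionS3 U Φ lam n)
    (a : RR4) (ha : ‖a‖ < 1) (hq : ∀ x ∈ U, Φ x - a ≠ 0) :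
    IsConformalImmersionS3 U (fun x => moebius a (Φ x))
        (fun x => lam x + Real.log (confFactor a (Φ x))) (fun x => reflq (Φ x - a) (n x)) := by
  have hc : 0 < 1 - ‖a‖ ^ 2 := by nlinarith [norm_nonneg a]
  have hr : ∀ x ∈ U, 0 < ‖Φ x - a‖ ^ 2 := fun x hx => pow_pos (norm_pos_iff.2 (hq x hx)) 2
  have hcf : ∀ x ∈ U, confFactor a (Φ x) = (1 - ‖a‖ ^ 2) * (‖Φ x - a‖ ^ 2)⁻¹ := by
    intro x hx
    rw [confFactor, rho_eq a _ (h.mem_sphere x hx), div_eq_mul_inv]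
  have hs : ∀ x ∈ U, 0 < (1 - ‖a‖ ^ 2) * (‖Φ x - a‖ ^ 2)⁻¹ :=
    fun x hx => mul_pos hc (inv_pos.2 (hr x hx))
  have e1 : ∀ x ∈ U, d1 (fun x => moebius a (Φ x)) x = _ :=
    fun x hx => fderiv_moebius U hU Φ a h.smooth_Phi hq (1, 0) x hx
  have e2 : ∀ x ∈ U, d2 (fun x => moebius a (Φ x)) x = _ :=
    fun x hx => fderiv_moebius U hU Φ a h.smooth_Phi hq (0, 1) x hx
  have e0 : ∀ x ∈ U, moebius a (Φ x) = _ :=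
    fun x hx => moebius_eq a (Φ x) (h.mem_sphere x hx) (hq x hx)
  refine ⟨moebius_smooth U Φ a h.smooth_Phi hq, ?_, reflq_smooth U Φ n a h.smooth_Phi h.smooth_n hq,
    ?_, ?_, ?_, ?_, ?_, ?_, ?_, ?_, ?_⟩
  · refine h.smooth_lam.add (ContDiffOn.log ?_ (fun x hx => by
      rw [hcf x hx]; exact (hs x hx).ne'))
    have h2 : ContDiffOn ℝ (⊤ : ℕ∞) (fun x => (‖Φ x - a‖ ^ 2)⁻¹) U :=
      ((h.smooth_Phi.sub contDiffOn_const).norm_sq ℝ).inv (fun x hx => (hr x hx).ne')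
    exact (contDiffOn_const.mul h2).congr hcf
  · intro x hx
    simp only [e0 x hx]
    rw [norm_neg, reflq_norm _ _ (hq x hx), h.mem_sphere x hx]
  · intro x hx
    rw [e1 x hx, e2 x hx, inner_smul_left, inner_smul_right, reflq_inner _ _ _ (hq x hx)]
    have := h.conf_orth x hx
    simp only [d1, d2] at this
    simp [this]
  · intro x hx
    rw [e1 x hx, norm_smul, reflq_norm _ _ (hq x hx), Real.exp_add, hcf x hx,
      Real.exp_log (hs x hx), Real.norm_of_nonneg (hs x hx).le, ← h.conf_norm1 x hx, mul_comm]
    rfl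
  · intro x hx
    rw [e2 x hx, norm_smul, reflq_norm _ _ (hq x hx), Real.exp_add, hcf x hx,
      Real.exp_log (hs x hx), Real.norm_of_nonneg (hs x hx).le, ← h.conf_norm2 x hx, mul_comm]
    rfl
  · intro x hx
    rw [reflq_norm _ _ (hq x hx), h.n_norm x hx]
  · intro x hx
    simp only [e0 x hx]
    rw [inner_neg_right, reflq_inner _ _ _ (hq x hx), h.n_orth_Phi x hx, neg_zero]
  · intro x hx
    rw [e1 x hx, inner_smul_right, reflq_inner _ _ _ (hq x hx)]
    have := h.n_orth_d1 x hx
    simp only [d1] at this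
    simp [this]
  · intro x hx
    rw [e2 x hx, inner_smul_right, reflq_inner _ _ _ (hq x hx)]
    have := h.n_orth_d2 x hx
    simp only [d2] at this
    simp [this]
  · intro x hx
    rw [e1 x hx, e2 x hx]
    simp only [e0 x hx]
    have h1 := det4_smul (-1) ((1 - ‖a‖ ^ 2) * (‖Φ x - a‖ ^ 2)⁻¹)
      ((1 - ‖a‖ ^ 2) * (‖Φ x - a‖ ^ 2)⁻¹) 1 (reflq (Φ x - a) (Φ x))
      (reflq (Φ x - a) (fderiv ℝ Φ x (1, 0))) (reflq (Φ x - a) (fderiv ℝ Φ x (0, 1)))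
      (reflq (Φ x - a) (n x))
    rw [det4_reflq _ _ _ _ _ (hq x hx), neg_one_smul, one_smul] at h1
    rw [h1]
    have h2 := h.oriented x hx
    have h3 := mul_pos (mul_pos (hs x hx) (hs x hx)) h2
    simp only [d1, d2] at h3
    linarith

/-- **mean curvature under Möbius transformations.** If `Φ : U → S³` is a
smooth conformal immersion with conformal factor `e^λ`, Gauss map `n` and mean curvature
`H`, and `|a| < 1`, then `Ψ_a ∘ Φ` is a smooth conformal immersion with conformal factor
`e^{λ+μ}`, `e^μ = confFactor a (Φ ·)`, and its mean curvature satisfies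
`H̃ = e^{-μ}(H - 2(a·n)/(1+|a|²-2a·Φ))` on `U`. -/
theorem mean_curvature_moebius_transformation
    (U : Set RR2) (hU : IsOpen U)
    (Φ : RR2 → RR4) (lam : RR2 → ℝ) (n : RR2 → RR4)
    (h : IsConformalImmersionS3 U Φ lam n)
    (a : RR4) (ha : ‖a‖ < 1) :
    (∃ nt : RR2 → RR4,
      IsConformalImmersionS3 U (fun x => moebius a (Φ x))
        (fun x => lam x + Real.log (confFactor a (Φ x))) nt) ∧
    ∀ nt : RR2 → RR4,
      IsConformalImmersionS3 U (fun x => moebius a (Φ x))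
        (fun x => lam x + Real.log (confFactor a (Φ x))) nt →
      ∀ x ∈ U,
        meanCurv (fun y => moebius a (Φ y))
            (fun y => lam y + Real.log (confFactor a (Φ y))) nt x
          = (confFactor a (Φ x))⁻¹
              * (meanCurv Φ lam n x
                  - 2 * ⟪a, n x⟫ / (1 + ‖a‖ ^ 2 - 2 * ⟪a, Φ x⟫)) := by
  have hq : ∀ x ∈ U, Φ x - a ≠ 0 := by
    intro x hx h0
    have := h.mem_sphere x hx
    rw [sub_eq_zero.1 h0] at this
    exact absurd this ha.ne
  have him := moebius_immersion U hU Φ lam n h a ha hq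
  refine ⟨⟨_, him⟩, ?_⟩
  intro nt hnt x hx
  have hnn : nt x = reflq (Φ x - a) (n x) :=
    normal_unique _ _ _ _ _ (hnt.n_norm x hx) (him.n_norm x hx) (hnt.n_orth_Phi x hx)
      (hnt.n_orth_d1 x hx) (hnt.n_orth_d2 x hx) (him.n_orth_Phi x hx)
      (him.n_orth_d1 x hx) (him.n_orth_d2 x hx) (hnt.oriented x hx) (him.oriented x hx)
  have hc : 0 < 1 - ‖a‖ ^ 2 := by nlinarith [norm_nonneg a]
  have hr : 0 < ‖Φ x - a‖ ^ 2 := pow_pos (norm_pos_iff.2 (hq x hx)) 2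
  have hin : ⟪Φ x - a, n x⟫ = - ⟪a, n x⟫ := by
    rw [inner_sub_left, real_inner_comm, h.n_orth_Phi x hx, zero_sub]
  have J1 := fderiv2_moebius U hU Φ a (n x) h.smooth_Phi hq (1, 0) x hx (h.n_orth_d1 x hx)
  have J2 := fderiv2_moebius U hU Φ a (n x) h.smooth_Phi hq (0, 1) x hx (h.n_orth_d2 x hx)
  have K1 : ‖fderiv ℝ Φ x (1, 0)‖ = exp (lam x) := h.conf_norm1 x hx
  have K2 : ‖fderiv ℝ Φ x (0, 1)‖ = exp (lam x) := h.conf_norm2 x hx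
  have L1 : ⟪n x, fderiv ℝ (fun y => fderiv ℝ Φ y (1, 0)) x (1, 0)⟫ = I11 Φ n x := rfl
  have L2 : ⟪n x, fderiv ℝ (fun y => fderiv ℝ Φ y (0, 1)) x (0, 1)⟫ = I22 Φ n x := rfl
  rw [← hnn, hin, K1, L1] at J1
  change I11 (fun y => moebius a (Φ y)) nt x = _ at J1
  rw [← hnn, hin, K2, L2] at J2
  change I22 (fun y => moebius a (Φ y)) nt x = _ at J2
  rw [meanCurv, meanCurv, J1, J2, confFactor, ← rho_eq a _ (h.mem_sphere x hx)]
  have hE : exp (-(2 * (lam x + Real.log ((1 - ‖a‖ ^ 2) / ‖Φ x - a‖ ^ 2)))) =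
      (exp (lam x) ^ 2)⁻¹ * (((1 - ‖a‖ ^ 2) / ‖Φ x - a‖ ^ 2) ^ 2)⁻¹ := by
    rw [Real.exp_neg, two_mul, Real.exp_add, Real.exp_add, Real.exp_log (div_pos hc hr), ← mul_inv]
    ring
  have hE2 : exp (-(2 * lam x)) = (exp (lam x) ^ 2)⁻¹ := by
    rw [Real.exp_neg, two_mul, Real.exp_add]; ring
  rw [hE, hE2]
  have he := Real.exp_pos (lam x)
  generalize exp (lam x) = E at *
  generalize ‖Φ x - a‖ ^ 2 = ρ at *
  generalize 1 - ‖a‖ ^ 2 = c at *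
  field_simp
  ring
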